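/- arXiv:1801.07147 — 2 statements merged into one kernel-verified Lean document; each statement's English description precedes it below -/
import Mathlib

section
/- Let (Ω, 𝒜) be a measurable space with a measure ν, let ι be a finite index type, let f : ι → Set Ω be a family of measurable sets, and let b : ι → ℝ≥0∞ be arbitrary weights. For X : Finset ι define the terraced ket-event ter X = (⋂ i ∈ X, f i) ∩ (⋂ i ∉ X, (f i)ᶜ). Then ∑ i, b i * ν (f i) = ∑ over all X : Finset ι of (∑ i ∈ X, b i) * ν (ter X). -/
open MeasureTheory ENNReal

theorem mem_terraced_iff {Ω ι : Type*} {f : ι → Set Ω} {X : Finset ι} {ω : Ω} :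
    ω ∈ (⋂ i ∈ X, f i) ∩ (⋂ i ∉ X, (f i)ᶜ) ↔ ∀ i, i ∈ X ↔ ω ∈ f i := by
  simp only [Set.mem_inter_iff, Set.mem_iInter, Set.mem_compl_iff]
  grind

theorem pairwise_disjoint_terraced {Ω ι : Type*} (f : ι → Set Ω) :
    Pairwise (Function.onFun Disjoint
      fun X : Finset ι => (⋂ i ∈ X, f i) ∩ (⋂ i ∉ X, (f i)ᶜ)) := by
  refine fun X Y hXY => Set.disjoint_left.2 fun ω hX hY => hXY (Finset.ext fun i => ?_)
  rw [mem_terraced_iff.1 hX i, mem_terraced_iff.1 hY i]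

theorem measurableSet_terraced {Ω ι : Type*} [MeasurableSpace Ω] [Countable ι]
    {f : ι → Set Ω} (hf : ∀ i, MeasurableSet (f i)) (X : Finset ι) :
    MeasurableSet ((⋂ i ∈ X, f i) ∩ (⋂ i ∉ X, (f i)ᶜ)) :=
  (MeasurableSet.iInter fun i => MeasurableSet.iInter fun _ => hf i).inter
    (MeasurableSet.iInter fun i => MeasurableSet.iInter fun _ => (hf i).compl)

open scoped Classical in
theorem eq_biUnion_terraced {Ω ι : Type*} [Fintype ι] (f : ι → Set Ω) (i : ι) :
    f i = ⋃ X ∈ Finset.univ.filter fun X : Finset ι => i ∈ X,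
      (⋂ j ∈ X, f j) ∩ (⋂ j ∉ X, (f j)ᶜ) := by
  ext ω
  simp only [Set.mem_iUnion, mem_terraced_iff, Finset.mem_filter, Finset.mem_univ, true_and,
    exists_prop]
  exact ⟨fun h => ⟨Finset.univ.filter fun j => ω ∈ f j, by simpa using h, by simp⟩,
    fun ⟨_, hi, hX⟩ => (hX i).1 hi⟩

open scoped Classical in
theorem measure_eq_sum_terraced {Ω ι : Type*} [MeasurableSpace Ω] (ν : Measure Ω) [Fintype ι]
    {f : ι → Set Ω} (hf : ∀ i, MeasurableSet (f i)) (i : ι) :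
    ν (f i) = ∑ X : Finset ι with i ∈ X, ν ((⋂ j ∈ X, f j) ∩ (⋂ j ∉ X, (f j)ᶜ)) := by
  conv_lhs => rw [eq_biUnion_terraced f i]
  exact measure_biUnion_finset ((pairwise_disjoint_terraced f).set_pairwise _)
    fun X _ => measurableSet_terraced hf X

theorem sum_braevents_eq_sum_terraced
    {Ω : Type*} [MeasurableSpace Ω] (ν : Measure Ω)
    {ι : Type*} [Fintype ι]
    (f : ι → Set Ω) (hf : ∀ i, MeasurableSet (f i))
    (b : ι → ℝ≥0∞) :
    ∑ i, b i * ν (f i) =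
      ∑ X : Finset ι,
        (∑ i ∈ X, b i) *
          ν ((⋂ i ∈ X, f i) ∩ (⋂ i ∉ X, (f i)ᶜ)) := by
  classical
  simp_rw [Finset.sum_mul]
  calc
    ∑ i, b i * ν (f i)
        = ∑ i, ∑ X : Finset ι with i ∈ X,
            b i * ν ((⋂ j ∈ X, f j) ∩ (⋂ j ∉ X, (f j)ᶜ)) :=
      Finset.sum_congr rfl fun i _ => by
        rw [measure_eq_sum_terraced ν hf i, Finset.mul_sum]
    _ = ∑ X : Finset ι, ∑ i ∈ X, b i * ν ((⋂ j ∈ X, f j) ∩ (⋂ j ∉ X, (f j)ᶜ)) :=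
      Finset.sum_comm' (by simp)
end

section
/- Let α and β be types and let R ⊆ α × β be any binary relation. For a : α define the cross-section sec a = {b : β | (a, b) ∈ R}, let 𝔛 = Set.range sec ⊆ Set (Set β) be the set of distinct cross-section values, and for s : Set β define the fiber ⟨s⟩ = {a : α | sec a = s}. For a subset X ⊆ 𝔛 define the terraced set ter(X) = {b : β | ∀ y ∈ 𝔛, (b ∈ y ↔ y ∈ X)}. Then for every x ∈ 𝔛 and every X ⊆ 𝔛 with ter(X) nonempty, the inclusion ⟨x⟩ ×ˢ ter(X) ⊆ R holds if and only if x ∈ X. -/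
theorem coevent_iff_membership
    {α β : Type*} (R : Set (α × β))
    (sec : α → Set β) (hsec : sec = fun a => {b : β | (a, b) ∈ R})
    (𝔛 : Set (Set β)) (h𝔛 : 𝔛 = Set.range sec)
    (x : Set β) (hx : x ∈ 𝔛)
    (X : Set (Set β)) (hX : X ⊆ 𝔛)
    (hne : ({b : β | ∀ y ∈ 𝔛, (b ∈ y ↔ y ∈ X)}).Nonempty) :
    ({a : α | sec a = x} ×ˢ {b : β | ∀ y ∈ 𝔛, (b ∈ y ↔ y ∈ X)}) ⊆ R ↔ x ∈ X := by
  have mem_sec : ∀ a b, b ∈ sec a ↔ (a, b) ∈ R := by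
    intro a b
    rw [hsec]
    rfl
  constructor
  · intro h
    obtain ⟨b, hb⟩ := hne
    obtain ⟨a, ha⟩ : ∃ a, sec a = x := by
      rw [h𝔛] at hx
      exact hx
    have hab : (a, b) ∈ R := h ⟨ha, hb⟩
    exact (hb x hx).1 (ha ▸ (mem_sec a b).2 hab)
  · rintro hxX ⟨a, b⟩ ⟨ha, hb⟩
    have hbx : b ∈ x := (hb x hx).2 hxX
    have ha' : sec a = x := ha
    exact (mem_sec a b).1 (ha' ▸ hbx)
end
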